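/- arXiv:2010.07834 — 6 statements merged into one kernel-verified Lean document; each statement's English description precedes it below -/
import Mathlib

section
/- Let ρ = S₀ … S_m (S_{m+1},O_{m+1},f_{m+1},i_{m+1}) … be an accepting super-tight run of Schewe(A) on a word w. Then ρ has a trunk τ = C_{m+1} C_{m+2} … and, moreover, for every k > m and every state q_k ∈ C_k there is a state q_{k+1} ∈ C_{k+1} such that f_k(q_k) = f_{k+1}(q_{k+1}). -/
/-!
Common definitions: Büchi automata, runs, languages, run DAGs and their ranks,
level rankings, tight rankings, the Schewe complementation construction and its
optimizations (Delay, SuccRank, RankSim, RankRestr, MaxRank).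
-/

noncomputable section
open scoped Classical

/-- A (nondeterministic) Büchi automaton with alphabet `A` and state type `Q`. -/
structure BA (A : Type*) (Q : Type*) where
  /-- transition function -/
  δ : Q → A → Set Q
  /-- initial states -/
  I : Set Q
  /-- accepting states -/
  F : Set Q

/-- Macrostates of the rank-based complement: the waiting part `wait S` and the
tight part `tight S O f i`. -/
inductive Mac (Q : Type*) where
  | wait : Set Q → Mac Q
  | tight : Set Q → Set Q → (Q → ℕ) → ℕ → Mac Q

namespace Mac

variable {Q : Type*}

/-- The `S`-component of a macrostate. -/
def S : Mac Q → Set Q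
  | wait S => S
  | tight S _ _ _ => S

/-- The `O`-component of a macrostate (defaulting to `∅` on the waiting part). -/
def Oc : Mac Q → Set Q
  | wait _ => ∅
  | tight _ O _ _ => O

/-- The ranking component of a macrostate (defaulting to `0` on the waiting part). -/
def fc : Mac Q → Q → ℕ
  | wait _ => fun _ => 0
  | tight _ _ f _ => f

/-- The `i`-component of a macrostate (defaulting to `0` on the waiting part). -/
def ic : Mac Q → ℕ
  | wait _ => 0
  | tight _ _ _ i => i

end Mac

namespace BA

variable {A : Type*} {Q : Type*}

/-- Transition function extended to sets of states. -/
def δS (M : BA A Q) (S : Set Q) (a : A) : Set Q := ⋃ q ∈ S, M.δ q a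

/-- `ρ` is a run of `M` on the infinite word `w`, starting in an initial state. -/
def IsRun (M : BA A Q) (w : ℕ → A) (ρ : ℕ → Q) : Prop :=
  ρ 0 ∈ M.I ∧ ∀ i, ρ (i + 1) ∈ M.δ (ρ i) (w i)

/-- A run is accepting iff it visits the accepting states infinitely often. -/
def Accepting (M : BA A Q) (ρ : ℕ → Q) : Prop :=
  ∀ n, ∃ i, n ≤ i ∧ ρ i ∈ M.F

/-- The ω-language of `M`. -/
def Lang (M : BA A Q) : Set (ℕ → A) :=
  {w | ∃ ρ, M.IsRun w ρ ∧ M.Accepting ρ}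

/-! ### Run DAGs and ranks of their vertices -/

/-- Vertices of the run DAG of `M` over `w`: `(q, i)` is a vertex iff some run of `M`
from `I` over `w` is at `q` at time `i`. -/
def dagV (M : BA A Q) (w : ℕ → A) : Set (Q × ℕ) :=
  {v | ∃ ρ, M.IsRun w ρ ∧ ρ v.2 = v.1}

/-- Edges of the run DAG of `M` over `w`. -/
def dagEdge (M : BA A Q) (w : ℕ → A) (u v : Q × ℕ) : Prop :=
  u ∈ M.dagV w ∧ v ∈ M.dagV w ∧ v.2 = u.2 + 1 ∧ v.1 ∈ M.δ u.1 (w u.2)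

/-- `v` is reachable from `u` inside the subgraph of the run DAG induced by the
vertex set `U`. -/
def reachIn (M : BA A Q) (w : ℕ → A) (U : Set (Q × ℕ)) (u v : Q × ℕ) : Prop :=
  u ∈ U ∧ Relation.ReflTransGen (fun x y => y ∈ U ∧ M.dagEdge w x y) u v

/-- The decreasing sequence of subgraphs `G⁰ ⊇ G¹ ⊇ …` used to assign ranks:
at an even stage `j` the *finite* vertices (those with finitely many vertices
reachable from them) are removed (getting rank `j`), at an odd stage `j` the
*endangered* vertices (those which cannot reach an accepting vertex) are removed
(getting rank `j`). -/
def dagG (M : BA A Q) (w : ℕ → A) : ℕ → Set (Q × ℕ)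
  | 0 => M.dagV w
  | j + 1 =>
      if Even j then
        {v ∈ M.dagG w j | ¬ Set.Finite {v' | M.reachIn w (M.dagG w j) v v'}}
      else
        {v ∈ M.dagG w j | ∃ v', M.reachIn w (M.dagG w j) v v' ∧ v'.1 ∈ M.F}

/-- The rank of a vertex of the run DAG of `M` over `w`: the stage at which the
vertex is removed, or `⊤` (i.e. ω) if it is never removed. -/
def dagRank (M : BA A Q) (w : ℕ → A) (v : Q × ℕ) : ℕ∞ :=
  sInf {j : ℕ∞ | ∃ n : ℕ, j = (n : ℕ∞) ∧ v ∈ M.dagG w n ∧ v ∉ M.dagG w (n + 1)}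

/-! ### Simulations -/

/-- `R` is a direct simulation relation on `M`. -/
def IsDirSimRel (M : BA A Q) (R : Q → Q → Prop) : Prop :=
  ∀ p r, R p r → (p ∈ M.F → r ∈ M.F) ∧
    ∀ a : A, ∀ p' ∈ M.δ p a, ∃ r' ∈ M.δ r a, R p' r'

/-- The (maximum) direct simulation `⊑_di` on `M`: the largest direct simulation
relation, i.e. the union of all direct simulation relations. -/
def DirSim (M : BA A Q) (p r : Q) : Prop :=
  ∃ R, M.IsDirSimRel R ∧ R p r

/-- The odd-rank simulation `⪯` on `M`: `p ⪯ r` iff for every word `w` and every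
position `i` such that `(p,i)` and `(r,i)` are vertices of the run DAG of `M`
over `w`, if both ranks are (finite and) odd then `rank_w(p,i) ≤ rank_w(r,i)`. -/
def OddRankSim (M : BA A Q) (p r : Q) : Prop :=
  ∀ w : ℕ → A, ∀ i : ℕ, (p, i) ∈ M.dagV w → (r, i) ∈ M.dagV w →
    ∀ np nr : ℕ, M.dagRank w (p, i) = (np : ℕ∞) → M.dagRank w (r, i) = (nr : ℕ∞) →
      Odd np → Odd nr → np ≤ nr

/-- The statically computed relation `⪯^R`: the smallest relation containing the
direct simulation and such that whenever for every letter `a` every state of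
`δ(p,a)∖F` is related to every state of `δ(r,a)∖F`, also `p` is related to `r`. -/
inductive RatSim (M : BA A Q) : Q → Q → Prop
  | base {p r : Q} : M.DirSim p r → RatSim M p r
  | step {p r : Q} :
      (∀ a : A, ∀ x ∈ M.δ p a \ M.F, ∀ y ∈ M.δ r a \ M.F, RatSim M x y) →
      RatSim M p r

/-! ### Level rankings and tightness -/

variable [Fintype Q]

/-- The rank of a ranking `f`, i.e. `max {f q | q : Q}`. -/
def rankOf (f : Q → ℕ) : ℕ := Finset.univ.sup f

/-- `f` is a level ranking for `M`: it is bounded by `2n` and assigns even ranks to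
accepting states. -/
def IsLevelRanking (M : BA A Q) (f : Q → ℕ) : Prop :=
  (∀ q, f q ≤ 2 * Fintype.card Q) ∧ ∀ q ∈ M.F, Even (f q)

/-- `f` is an `S`-tight level ranking: its rank is odd, every odd number up to its
rank is attained on `S`, and `f` is `0` outside of `S`. -/
def IsTight (M : BA A Q) (S : Set Q) (f : Q → ℕ) : Prop :=
  M.IsLevelRanking f ∧ Odd (rankOf f) ∧
  (∀ j, Odd j → j ≤ rankOf f → ∃ s ∈ S, f s = j) ∧
  ∀ q ∉ S, f q = 0

/-- Membership of `(S, O, f, i)` in the tight part `Q₂` of the Schewe construction. -/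
def InQ2 (M : BA A Q) (S O : Set Q) (f : Q → ℕ) (i : ℕ) : Prop :=
  M.IsTight S f ∧ O ⊆ S ∩ {q | f q = i} ∧ Even i ∧ i + 2 ≤ 2 * Fintype.card Q

/-- The `δ₃` transition relation of the Schewe construction (on the raw components). -/
def Delta3 (M : BA A Q) (S O : Set Q) (f : Q → ℕ) (i : ℕ) (a : A)
    (S' O' : Set Q) (f' : Q → ℕ) (i' : ℕ) : Prop :=
  S' = M.δS S a ∧ (∀ q ∈ S, ∀ q' ∈ M.δ q a, f' q' ≤ f q) ∧
  rankOf f' = rankOf f ∧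
  ((O = ∅ ∧ i' = (i + 2) % (rankOf f' + 1) ∧ O' = {q | f' q = i'}) ∨
   (O ≠ ∅ ∧ i' = i ∧ O' = M.δS O a ∩ {q | f' q = i'}))

/-! ### The Schewe construction -/

/-- The transition function of `Schewe(M)`. -/
def scheweDelta (M : BA A Q) : Mac Q → A → Set (Mac Q)
  | .wait S, a =>
      {Mac.wait (M.δS S a)} ∪
      {m | ∃ f, m = Mac.tight (M.δS S a) ∅ f 0 ∧ M.InQ2 (M.δS S a) ∅ f 0}
  | .tight S O f i, a =>
      {m | ∃ S' O' f' i', m = Mac.tight S' O' f' i' ∧ M.InQ2 S' O' f' i' ∧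
           M.Delta3 S O f i a S' O' f' i'}

/-- The accepting macrostates of `Schewe(M)`: the empty waiting macrostate, and the
tight macrostates with empty `O`-component. -/
def scheweAccept (M : BA A Q) : Set (Mac Q) :=
  {Mac.wait (∅ : Set Q)} ∪ {m | ∃ S f i, m = Mac.tight S ∅ f i ∧ M.InQ2 S ∅ f i}

/-- The Schewe complement automaton `Schewe(M)`. -/
def schewe (M : BA A Q) : BA A (Mac Q) :=
  ⟨M.scheweDelta, {Mac.wait M.I}, M.scheweAccept⟩

/-- The run `ρ` of the complement construction moves from the waiting part to the
tight part at position `m`. -/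
def SwitchesAt (ρ : ℕ → Mac Q) (m : ℕ) : Prop :=
  (∀ k ≤ m, ∃ S, ρ k = Mac.wait S) ∧ ∀ k, m < k → ∃ S O f i, ρ k = Mac.tight S O f i

/-- A run of the complement construction (switching to the tight part at `m`) is
super-tight if in the tight part its rankings coincide with the ranks of the
corresponding vertices of the run DAG of `M` over `w`. -/
def SuperTight (M : BA A Q) (w : ℕ → A) (ρ : ℕ → Mac Q) (m : ℕ) : Prop :=
  ∀ k, m < k → ∀ q ∈ (ρ k).S, (((ρ k).fc q : ℕ∞)) = M.dagRank w (q, k)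

/-! ### Tight cores and trunks -/

/-- `C` is a tight core of the ranking `f`: `f(C) = {1, 3, …, rank f}` and `f` is
injective on `C`. -/
def TightCore (f : Q → ℕ) (C : Set Q) : Prop :=
  f '' C = {j | Odd j ∧ j ≤ rankOf f} ∧ Set.InjOn f C

/-- `τ` is a trunk of the run `ρ` (switching at `m`): for every `k > m`, `τ k` is a
tight core of the macrostate `ρ k` and there is a bijection `θ : τ k → τ (k+1)`
respecting the transition function. -/
def IsTrunk (M : BA A Q) (w : ℕ → A) (ρ : ℕ → Mac Q) (m : ℕ) (τ : ℕ → Set Q) : Prop :=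
  ∀ k, m < k → τ k ⊆ (ρ k).S ∧ TightCore ((ρ k).fc) (τ k) ∧
    ∃ θ : Q → Q, Set.BijOn θ (τ k) (τ (k + 1)) ∧ ∀ q ∈ τ k, θ q ∈ M.δ q (w k)

/-! ### The Delay optimization -/

/-- Iterated (deterministic) successor of a set of states along a finite word. -/
def dSteps (M : BA A Q) : List A → Set Q → Set Q
  | [], S => S
  | a :: u, S => M.dSteps u (M.δS S a)

/-- The `δ₁`-transition `S →a δ(S,a)` closes a cycle in the waiting part, i.e. `S` is
reachable from `δ(S,a)` in the deterministic subset automaton. -/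
def ClosesCycle (M : BA A Q) (S : Set Q) (a : A) : Prop :=
  ∃ u : List A, M.dSteps u (M.δS S a) = S

/-- The transition function of `Delay(M)`: the waiting-to-tight transitions are only
kept when the corresponding waiting transition closes a cycle. -/
def delayDelta (M : BA A Q) : Mac Q → A → Set (Mac Q)
  | .wait S, a =>
      {Mac.wait (M.δS S a)} ∪
      {m | M.ClosesCycle S a ∧
           ∃ f, m = Mac.tight (M.δS S a) ∅ f 0 ∧ M.InQ2 (M.δS S a) ∅ f 0}
  | .tight S O f i, a => M.scheweDelta (Mac.tight S O f i) a

/-- The `Delay(M)` automaton. -/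
def delay (M : BA A Q) : BA A (Mac Q) :=
  ⟨M.delayDelta, {Mac.wait M.I}, M.scheweAccept⟩

/-! ### The SuccRank optimization -/

/-- Iterated successor of a set of states along an infinite word. -/
def dIter (M : BA A Q) (w : ℕ → A) (S : Set Q) : ℕ → Set Q
  | 0 => S
  | n + 1 => M.δS (M.dIter w S n) (w n)

/-- `infreach S`: the sets of states occurring infinitely often on some infinite path
of the deterministic subset automaton starting in `S` (equivalently, the union of
all strongly connected components reachable from `S`). -/
def infreach (M : BA A Q) (S : Set Q) : Set (Set Q) :=
  {R | ∃ w : ℕ → A, ∀ m : ℕ, ∃ n, m ≤ n ∧ M.dIter w S n = R}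

/-- `maxinfreach S = max {|R ∖ F| : R ∈ infreach S}`. -/
def maxinfreach (M : BA A Q) (S : Set Q) : ℕ :=
  sSup {n | ∃ R ∈ M.infreach S, n = (R \ M.F).ncard}

/-- `mininfreach S = min {|R ∖ F| : R ∈ infreach S}`. -/
def mininfreach (M : BA A Q) (S : Set Q) : ℕ :=
  sInf {n | ∃ R ∈ M.infreach S, n = (R \ M.F).ncard}

/-- The coarse SuccRank condition: `rank f ≤ 2·maxinfreach S − 1`. -/
def CondCoarse (M : BA A Q) (S : Set Q) (f : Q → ℕ) : Prop :=
  (rankOf f : ℤ) ≤ 2 * (M.maxinfreach S : ℤ) - 1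

/-- The fine SuccRank condition:
`rank f ≤ min {f q + 2·(maxinfreach S − mininfreach {q}) : q ∈ S}`. -/
def CondFine (M : BA A Q) (S : Set Q) (f : Q → ℕ) : Prop :=
  ∀ q ∈ S, (rankOf f : ℤ) ≤ (f q : ℤ) + 2 * ((M.maxinfreach S : ℤ) - (M.mininfreach {q} : ℤ))

/-- `Schewe(M)` with the tight-part macrostates restricted to those satisfying `P`. -/
def restrictTight (M : BA A Q) (P : Set Q → Set Q → (Q → ℕ) → ℕ → Prop) : BA A (Mac Q) :=
  ⟨fun m a => {m' | m' ∈ M.scheweDelta m a ∧ ∀ S O f i, m' = Mac.tight S O f i → P S O f i},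
   {Mac.wait M.I},
   {m | m ∈ M.scheweAccept ∧ ∀ S O f i, m = Mac.tight S O f i → P S O f i}⟩

/-! ### The RankSim optimization -/

/-- The RankSim condition on a macrostate with components `S` and `f`, with respect to
the odd-rank simulation `⪯`: whenever `p (⪯_f)⁺ r` for `p, r ∈ S`, also `f p ≤ f r`. -/
def RankSimCond (M : BA A Q) (S : Set Q) (f : Q → ℕ) : Prop :=
  ∀ p ∈ S, ∀ r ∈ S,
    Relation.TransGen (fun x y => Odd (f x) ∧ Odd (f y) ∧ M.OddRankSim x y) p r → f p ≤ f r

/-- The RankSim' condition, using the statically computed relation `⪯^R` instead of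
the odd-rank simulation. -/
def RankSimCondR (M : BA A Q) (S : Set Q) (f : Q → ℕ) : Prop :=
  ∀ p ∈ S, ∀ r ∈ S,
    Relation.TransGen (fun x y => Odd (f x) ∧ Odd (f y) ∧ M.RatSim x y) p r → f p ≤ f r

/-! ### The RankRestr optimization -/

/-- The `RankRestr(M)` automaton: `Schewe(M)` with the tight-part transitions
restricted to those where every odd-ranked state has a successor of the same rank. -/
def rankRestr (M : BA A Q) : BA A (Mac Q) :=
  ⟨fun m a => {m' | m' ∈ M.scheweDelta m a ∧
      ∀ S O f i S' O' f' i', m = Mac.tight S O f i → m' = Mac.tight S' O' f' i' →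
        ∀ q ∈ S, Odd (f q) → ∃ q' ∈ M.δ q a, f' q' = f q},
   {Mac.wait M.I}, M.scheweAccept⟩

/-! ### The MaxRank construction -/

/-- The auxiliary transition function `η#`: the waiting-to-tight transitions of
`Delay(M)` whose targets satisfy RankSim' and SuccRank. -/
def EtaAux (M : BA A Q) (S : Set Q) (a : A) : Set (Mac Q) :=
  {m | M.ClosesCycle S a ∧
       ∃ f, m = Mac.tight (M.δS S a) ∅ f 0 ∧ M.InQ2 (M.δS S a) ∅ f 0 ∧
         M.RankSimCondR (M.δS S a) f ∧ M.CondCoarse (M.δS S a) f ∧ M.CondFine (M.δS S a) f}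

/-- The order on macrostates used for `η₂`: macrostates with the same `S`, `O` and `i`
components are compared by their rankings, pointwise. -/
def MacLE : Mac Q → Mac Q → Prop
  | Mac.wait S, Mac.wait S' => S = S'
  | Mac.tight S O f i, Mac.tight S' O' g i' => S = S' ∧ O = O' ∧ i = i' ∧ ∀ q, f q ≤ g q
  | _, _ => False

/-- `η₂`: the maximal elements of `η#` with respect to the pointwise order on rankings. -/
def eta2 (M : BA A Q) (S : Set Q) (a : A) : Set (Mac Q) :=
  {m | m ∈ M.EtaAux S a ∧ ∀ m' ∈ M.EtaAux S a, MacLE m m' → MacLE m' m}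

/-- The maximal successor ranking of `(S, f)` under letter `a`: for
`q' ∈ δ(S,a)`, with `r = min {f s : s ∈ δ⁻¹(q',a) ∩ S}`, it is `r − 1` if `r` is odd
and `q' ∈ F`, and `r` otherwise; it is `0` outside `δ(S,a)`. -/
def fmax (M : BA A Q) (S : Set Q) (f : Q → ℕ) (a : A) (q' : Q) : ℕ :=
  if q' ∈ M.δS S a then
    let r := sInf {n | ∃ s ∈ S, q' ∈ M.δ s a ∧ f s = n}
    if Odd r ∧ q' ∈ M.F then r - 1 else r
  else 0

/-- `η₃`: the (at most one) `δ₃`-successor carrying the maximal successor ranking. -/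
def eta3 (M : BA A Q) (S O : Set Q) (f : Q → ℕ) (i : ℕ) (a : A) : Set (Mac Q) :=
  {m | ∃ S' O' i', m = Mac.tight S' O' (M.fmax S f a) i' ∧
       m ∈ M.scheweDelta (Mac.tight S O f i) a}

/-- `η₄`: obtained from the `η₃`-successor `(S', P', h', i')` by decreasing the rank of
every non-accepting state of `P'` by one (defined only when `i' ≠ 0`). -/
def eta4 (M : BA A Q) (S O : Set Q) (f : Q → ℕ) (i : ℕ) (a : A) : Set (Mac Q) :=
  {m | ∃ S' P' h' i', Mac.tight S' P' h' i' ∈ M.eta3 S O f i a ∧ i' ≠ 0 ∧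
       m = Mac.tight S'
         (P' ∩ {q | (if q ∈ P' ∧ q ∉ M.F then h' q - 1 else h' q) = i'})
         (fun u => if u ∈ P' ∧ u ∉ M.F then h' u - 1 else h' u) i'}

/-- The transition function of `MaxRank(M)`. -/
def maxRankDelta (M : BA A Q) : Mac Q → A → Set (Mac Q)
  | .wait S, a => {Mac.wait (M.δS S a)} ∪ M.eta2 S a
  | .tight S O f i, a => M.eta3 S O f i a ∪ M.eta4 S O f i a

/-- The `MaxRank(M)` automaton. -/
def maxRank (M : BA A Q) : BA A (Mac Q) :=
  ⟨M.maxRankDelta, {Mac.wait M.I}, M.scheweAccept⟩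

end BA

/-! ### Statement -/

open BA

theorem dagG_succ_subset {A Q : Type*} (M : BA A Q) (w : ℕ → A) (j : ℕ) :
    M.dagG w (j + 1) ⊆ M.dagG w j := by
  intro v hv
  rw [BA.dagG] at hv
  split_ifs at hv <;> exact hv.1

theorem dagG_antitone {A Q : Type*} (M : BA A Q) (w : ℕ → A) : Antitone (M.dagG w) :=
  antitone_nat_of_succ_le (dagG_succ_subset M w)

theorem dagRank_eq_iff {A Q : Type*} (M : BA A Q) (w : ℕ → A) (v : Q × ℕ) (n : ℕ) :
    M.dagRank w v = (n : ℕ∞) ↔ v ∈ M.dagG w n ∧ v ∉ M.dagG w (n + 1) := by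
  have key : ∀ a b : ℕ, v ∉ M.dagG w (a + 1) → v ∈ M.dagG w b → b ≤ a := by
    intro a b ha hb
    by_contra hlt
    exact ha (dagG_antitone M w (by omega : a + 1 ≤ b) hb)
  constructor
  · intro h
    have hne : {j : ℕ∞ | ∃ n : ℕ, j = (n : ℕ∞) ∧ v ∈ M.dagG w n ∧
        v ∉ M.dagG w (n + 1)}.Nonempty := by
      rw [Set.nonempty_iff_ne_empty]
      intro he
      rw [BA.dagRank, he, sInf_empty] at h
      exact absurd h (ENat.natCast_ne_top n).symm
    have hm := csInf_mem hne
    obtain ⟨a, ha, h1, h2⟩ := hm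
    have : (n : ℕ∞) = a := by rw [← h, ← ha]; rfl
    have : n = a := by exact_mod_cast this
    subst this
    exact ⟨h1, h2⟩
  · rintro ⟨h1, h2⟩
    have : {j : ℕ∞ | ∃ n : ℕ, j = (n : ℕ∞) ∧ v ∈ M.dagG w n ∧
        v ∉ M.dagG w (n + 1)} = {(n : ℕ∞)} := by
      ext j
      constructor
      · rintro ⟨a, rfl, h3, h4⟩
        have := key a n h4 h1
        have := key n a h2 h3
        have : a = n := by omega
        simp [this]
      · rintro rfl
        exact ⟨n, rfl, h1, h2⟩
    rw [BA.dagRank, this, sInf_singleton]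

theorem mem_dagG_even {A Q : Type*} (M : BA A Q) (w : ℕ → A) (j : ℕ) (h : Even j)
    (v : Q × ℕ) : v ∈ M.dagG w (j + 1) ↔
      v ∈ M.dagG w j ∧ ¬ Set.Finite {v' | M.reachIn w (M.dagG w j) v v'} := by
  have : M.dagG w (j + 1) =
      {v ∈ M.dagG w j | ¬ Set.Finite {v' | M.reachIn w (M.dagG w j) v v'}} := if_pos h
  rw [this]; rfl

theorem mem_dagG_odd {A Q : Type*} (M : BA A Q) (w : ℕ → A) (j : ℕ) (h : ¬ Even j)
    (v : Q × ℕ) : v ∈ M.dagG w (j + 1) ↔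
      v ∈ M.dagG w j ∧ ∃ v', M.reachIn w (M.dagG w j) v v' ∧ v'.1 ∈ M.F := by
  have : M.dagG w (j + 1) =
      {v ∈ M.dagG w j | ∃ v', M.reachIn w (M.dagG w j) v v' ∧ v'.1 ∈ M.F} := if_neg h
  rw [this]; rfl

/-- A vertex of odd rank has a successor of the same rank. -/
theorem odd_succ {A Q : Type*} [Fintype Q] (M : BA A Q) (w : ℕ → A) (q : Q) (k j : ℕ)
    (hj : Odd j) (h : M.dagRank w (q, k) = (j : ℕ∞)) :
    ∃ q' ∈ M.δ q (w k), M.dagRank w (q', k + 1) = (j : ℕ∞) := by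
  rw [dagRank_eq_iff] at h
  obtain ⟨h1, h2⟩ := h
  obtain ⟨i, rfl⟩ := hj
  have he : Even (2 * i) := even_two_mul i
  have hne : ¬ Even (2 * i + 1) := by simp
  have h1' := h1
  rw [mem_dagG_even M w _ he] at h1'
  obtain ⟨hv, hinf⟩ := h1'
  have hex : ∃ q', (q', k + 1) ∈ M.dagG w (2 * i) ∧ M.dagEdge w (q, k) (q', k + 1) ∧
      ¬ Set.Finite {v' | M.reachIn w (M.dagG w (2 * i)) (q', k + 1) v'} := by
    by_contra hcon
    push Not at hcon
    apply hinf
    have hfin : Set.Finite ({(q, k)} ∪ ⋃ q' ∈ {q' : Q | (q', k + 1) ∈ M.dagG w (2 * i) ∧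
        M.dagEdge w (q, k) (q', k + 1)},
        {v' | M.reachIn w (M.dagG w (2 * i)) (q', k + 1) v'}) := by
      refine (Set.finite_singleton _).union (Set.Finite.biUnion (Set.toFinite _) ?_)
      rintro q' ⟨ha, hb⟩
      exact hcon q' ha hb
    refine hfin.subset ?_
    rintro v' ⟨_, hr⟩
    rcases Relation.ReflTransGen.cases_head hr with rfl | ⟨⟨c, t⟩, ⟨hc, hed⟩, hr'⟩
    · left; rfl
    · right
      have ht : t = k + 1 := hed.2.2.1
      subst ht
      simp only [Set.mem_iUnion]
      exact ⟨c, ⟨hc, hed⟩, hc, hr'⟩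
  obtain ⟨q', hq', hed, hq'inf⟩ := hex
  refine ⟨q', hed.2.2.2, ?_⟩
  rw [dagRank_eq_iff]
  have hmem : (q', k + 1) ∈ M.dagG w (2 * i + 1) := by
    rw [mem_dagG_even M w _ he]; exact ⟨hq', hq'inf⟩
  refine ⟨hmem, ?_⟩
  intro hbad
  apply h2
  rw [mem_dagG_odd M w _ hne] at hbad ⊢
  obtain ⟨_, v', ⟨_, hr⟩, hF⟩ := hbad
  exact ⟨h1, v', ⟨h1, Relation.ReflTransGen.head ⟨hmem, hed⟩ hr⟩, hF⟩

theorem stmt2 {A Q : Type*} [Fintype A] [Nonempty A] [Fintype Q] (M : BA A Q)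
    (w : ℕ → A) (ρ : ℕ → Mac Q) (m : ℕ)
    (hrun : (BA.schewe M).IsRun w ρ) (hacc : (BA.schewe M).Accepting ρ)
    (hsw : BA.SwitchesAt ρ m) (hst : M.SuperTight w ρ m) :
    ∃ τ : ℕ → Set Q, M.IsTrunk w ρ m τ ∧
      ∀ k, m < k → ∀ q ∈ τ k, ∃ q' ∈ τ (k + 1), (ρ k).fc q = (ρ (k + 1)).fc q' := by
  have hstep : ∀ k, m < k → (ρ (k + 1)).S = M.δS (ρ k).S (w k) ∧
      rankOf (ρ (k + 1)).fc = rankOf (ρ k).fc := by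
    intro k hk
    obtain ⟨S, O, f, i, e⟩ := hsw.2 k hk
    have h := hrun.2 k
    rw [e] at h
    obtain ⟨S', O', f', i', e', _, hd⟩ := h
    rw [e, e']
    exact ⟨hd.1, hd.2.2.1⟩
  have hth : ∀ k q, ∃ q', m < k → q ∈ (ρ k).S → Odd ((ρ k).fc q) →
      q' ∈ M.δ q (w k) ∧ q' ∈ (ρ (k + 1)).S ∧ (ρ (k + 1)).fc q' = (ρ k).fc q := by
    intro k q
    by_cases hc : m < k ∧ q ∈ (ρ k).S ∧ Odd ((ρ k).fc q)
    · obtain ⟨hk, hq, ho⟩ := hc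
      obtain ⟨q', hd, hr⟩ := odd_succ M w q k _ ho (hst k hk q hq).symm
      have hS : q' ∈ (ρ (k + 1)).S := by
        rw [(hstep k hk).1]
        exact Set.mem_biUnion hq hd
      refine ⟨q', fun _ _ _ => ⟨hd, hS, ?_⟩⟩
      have := hst (k + 1) (by omega) q' hS
      rw [hr] at this
      exact_mod_cast this
    · exact ⟨q, fun a b c => absurd ⟨a, b, c⟩ hc⟩
  choose θ hθ using hth
  have hinit : ∃ C : Set Q, C ⊆ (ρ (m + 1)).S ∧ TightCore (ρ (m + 1)).fc C := by
    obtain ⟨S, e⟩ := hsw.1 m le_rfl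
    obtain ⟨S1, O1, f1, i1, e1⟩ := hsw.2 (m + 1) (by omega)
    have h := hrun.2 m
    rw [e] at h
    rcases h with h | ⟨f, e', hQ⟩
    · rw [e1] at h; cases h
    · rw [e']
      have ht := hQ.1.2.2.1
      have hex : ∀ j, ∃ s, Odd j → j ≤ rankOf f → s ∈ M.δS S (w m) ∧ f s = j := by
        intro j
        by_cases hc : Odd j ∧ j ≤ rankOf f
        · obtain ⟨s, hs⟩ := ht j hc.1 hc.2
          exact ⟨s, fun _ _ => hs⟩
        · by_cases hQe : Nonempty Q
          · exact ⟨hQe.some, fun a b => absurd ⟨a, b⟩ hc⟩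
          · exfalso
            apply hQe
            obtain ⟨s, _⟩ := ht _ hQ.1.2.1 le_rfl
            exact ⟨s⟩
      choose s hs using hex
      refine ⟨s '' {j | Odd j ∧ j ≤ rankOf f}, ?_, ?_, ?_⟩
      · rintro _ ⟨j, hj, rfl⟩
        exact (hs j hj.1 hj.2).1
      · ext j
        constructor
        · rintro ⟨_, ⟨j', hj', rfl⟩, rfl⟩
          change Odd (f _) ∧ f _ ≤ rankOf f
          rw [(hs j' hj'.1 hj'.2).2]
          exact hj'
        · intro hj
          exact ⟨s j, ⟨j, hj, rfl⟩, (hs j hj.1 hj.2).2⟩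
      · rintro _ ⟨j, hj, rfl⟩ _ ⟨j', hj', rfl⟩ hjj
        change f _ = f _ at hjj
        rw [(hs j hj.1 hj.2).2, (hs j' hj'.1 hj'.2).2] at hjj
        rw [hjj]
  obtain ⟨C, hCS, hC⟩ := hinit
  let c : ℕ → Set Q := fun d => Nat.rec C (fun d X => θ (m + 1 + d) '' X) d
  have hc : ∀ d, c (d + 1) = θ (m + 1 + d) '' c d := fun d => rfl
  have hodd : ∀ k (X : Set Q), TightCore (ρ k).fc X → ∀ q ∈ X, Odd ((ρ k).fc q) := by
    intro k X hX q hq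
    have : (ρ k).fc q ∈ (ρ k).fc '' X := ⟨q, hq, rfl⟩
    rw [hX.1] at this
    exact this.1
  have hinv : ∀ d, c d ⊆ (ρ (m + 1 + d)).S ∧ TightCore (ρ (m + 1 + d)).fc (c d) := by
    intro d
    induction d with
    | zero => exact ⟨hCS, hC⟩
    | succ d ih =>
      obtain ⟨ih1, ih2⟩ := ih
      have hk : m < m + 1 + d := by omega
      have hall := fun q (hq : q ∈ c d) => hθ (m + 1 + d) q hk (ih1 hq) (hodd _ _ ih2 q hq)
      rw [hc]
      change _ ⊆ (ρ (m + 1 + d + 1)).S ∧ TightCore (ρ (m + 1 + d + 1)).fc _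
      refine ⟨?_, ?_, ?_⟩
      · rintro _ ⟨q, hq, rfl⟩
        exact (hall q hq).2.1
      · rw [(hstep _ hk).2, ← ih2.1, Set.image_image]
        exact Set.image_congr (fun q hq => (hall q hq).2.2)
      · rintro _ ⟨q, hq, rfl⟩ _ ⟨q', hq', rfl⟩ he
        rw [(hall q hq).2.2, (hall q' hq').2.2] at he
        rw [ih2.2 hq hq' he]
  have hmain : ∀ k, m < k → ∃ d, k = m + 1 + d ∧ k - (m + 1) = d ∧ k + 1 - (m + 1) = d + 1 :=
    fun k hk => ⟨k - (m + 1), by omega, rfl, by omega⟩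
  refine ⟨fun k => c (k - (m + 1)), ?_, ?_⟩
  · intro k hk
    obtain ⟨d, rfl, e1, e2⟩ := hmain k hk
    simp only [e1, e2]
    obtain ⟨ih1, ih2⟩ := hinv d
    have hall := fun q (hq : q ∈ c d) => hθ (m + 1 + d) q hk (ih1 hq) (hodd _ _ ih2 q hq)
    refine ⟨ih1, ih2, θ (m + 1 + d), ⟨?_, ?_, ?_⟩, fun q hq => (hall q hq).1⟩
    · intro q hq
      rw [hc]; exact ⟨q, hq, rfl⟩
    · intro q hq q' hq' he
      apply ih2.2 hq hq'
      rw [← (hall q hq).2.2, ← (hall q' hq').2.2, he]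
    · rw [hc]; exact fun x hx => hx
  · intro k hk
    obtain ⟨d, rfl, e1, e2⟩ := hmain k hk
    simp only [e1, e2]
    obtain ⟨ih1, ih2⟩ := hinv d
    intro q hq
    refine ⟨θ (m + 1 + d) q, ?_, (hθ (m + 1 + d) q hk (ih1 hq) (hodd _ _ ih2 q hq)).2.2.symm⟩
    rw [hc]; exact ⟨q, hq, rfl⟩
end
end

section
/- Let A be a Büchi automaton, w an infinite word, and G_w the run DAG of A over w. If (q,i) is a vertex of G_w whose rank rank_w(q,i) is a finite odd number, then there exists a direct successor vertex (q',i+1) of (q,i) in G_w (i.e., q' ∈ δ(q,w_i)) with rank_w(q',i+1) = rank_w(q,i); consequently there is an infinite path in G_w starting at (q,i) all of whose vertices have rank rank_w(q,i). -/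
/-!
Common definitions: Büchi automata, runs, languages, run DAGs and their ranks,
level rankings, tight rankings, the Schewe complementation construction and its
optimizations (Delay, SuccRank, RankSim, RankRestr, MaxRank).
-/

noncomputable section
open scoped Classical

/-! ### Statement -/

open BA

namespace BA

theorem dagG_succ_subset {A Q : Type*} (M : BA A Q) (w : ℕ → A) (j : ℕ) :
    M.dagG w (j + 1) ⊆ M.dagG w j := by
  intro v hv
  rw [dagG] at hv
  split_ifs at hv
  · exact hv.1
  · exact hv.1

theorem dagG_anti {A Q : Type*} (M : BA A Q) (w : ℕ → A) : Antitone (M.dagG w) :=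
  antitone_nat_of_succ_le (M.dagG_succ_subset w)

theorem dagRank_eq_iff {A Q : Type*} (M : BA A Q) (w : ℕ → A) (v : Q × ℕ) (r : ℕ) :
    M.dagRank w v = (r : ℕ∞) ↔ v ∈ M.dagG w r ∧ v ∉ M.dagG w (r + 1) := by
  have key : ∀ n : ℕ, v ∈ M.dagG w n → v ∉ M.dagG w (n + 1) → M.dagRank w v = (n : ℕ∞) := by
    intro n h1 h2
    have : {j : ℕ∞ | ∃ n : ℕ, j = (n : ℕ∞) ∧ v ∈ M.dagG w n ∧ v ∉ M.dagG w (n + 1)}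
        = {(n : ℕ∞)} := by
      ext x
      constructor
      · rintro ⟨m, rfl, h3, h4⟩
        have hmn : m = n := by
          rcases lt_trichotomy m n with h | h | h
          · exact absurd (M.dagG_anti w (Nat.succ_le_of_lt h) h1) h4
          · exact h
          · exact absurd (M.dagG_anti w (Nat.succ_le_of_lt h) h3) h2
        simp [hmn]
      · intro hx
        exact ⟨n, hx, h1, h2⟩
    rw [dagRank, this, sInf_singleton]
  constructor
  · intro h
    by_cases hne : ∃ n : ℕ, v ∈ M.dagG w n ∧ v ∉ M.dagG w (n + 1)
    · obtain ⟨n, h1, h2⟩ := hne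
      have h3 := key n h1 h2
      rw [h] at h3
      have h4 : r = n := by exact_mod_cast h3
      subst h4
      exact ⟨h1, h2⟩
    · exfalso
      have : {j : ℕ∞ | ∃ n : ℕ, j = (n : ℕ∞) ∧ v ∈ M.dagG w n ∧ v ∉ M.dagG w (n + 1)} = ∅ := by
        ext x
        simp only [Set.mem_setOf_eq, Set.mem_empty_iff_false, iff_false]
        rintro ⟨n, -, h1⟩
        exact hne ⟨n, h1⟩
      rw [dagRank, this, sInf_empty] at h
      exact ENat.top_ne_coe r h
  · rintro ⟨h1, h2⟩
    exact key r h1 h2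

theorem odd_rank_step {A Q : Type*} [Finite Q] (M : BA A Q) (w : ℕ → A) (v : Q × ℕ)
    (r : ℕ) (hr : M.dagRank w v = (r : ℕ∞)) (hodd : Odd r) :
    ∃ u, M.dagEdge w v u ∧ M.dagRank w u = (r : ℕ∞) := by
  rw [dagRank_eq_iff] at hr
  obtain ⟨h1, h2⟩ := hr
  have hne : ¬ Even r := Nat.not_even_iff_odd.mpr hodd
  have hnacc : ∀ v', M.reachIn w (M.dagG w r) v v' → v'.1 ∉ M.F := by
    intro v' hv' hF
    apply h2
    rw [dagG, if_neg hne]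
    exact ⟨h1, v', hv', hF⟩
  obtain ⟨j, rfl⟩ : ∃ j, r = j + 1 := ⟨r - 1, by have := hodd.pos; omega⟩
  have hje : Even j := by
    by_contra h
    exact hne (Nat.not_even_iff_odd.mp h).add_one
  have hG : M.dagG w (j + 1) =
      {v ∈ M.dagG w j | ¬ Set.Finite {v' | M.reachIn w (M.dagG w j) v v'}} := by
    rw [dagG, if_pos hje]
  have h1' := h1
  rw [hG] at h1'
  obtain ⟨hvj, hinf⟩ := h1'
  have hex : ∃ u ∈ M.dagG w j, M.dagEdge w v u ∧
      ¬ Set.Finite {v' | M.reachIn w (M.dagG w j) u v'} := by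
    by_contra hcon
    push Not at hcon
    apply hinf
    have hfin : Set.Finite {u | u ∈ M.dagG w j ∧ M.dagEdge w v u} := by
      apply Set.Finite.subset (Set.finite_range (fun q : Q => (q, v.2 + 1)))
      rintro ⟨p, k⟩ ⟨-, -, -, hk, -⟩
      exact ⟨p, by simp at hk; simp [hk]⟩
    apply Set.Finite.subset ((Set.finite_singleton v).union
      (hfin.biUnion (fun u hu => hcon u hu.1 hu.2)))
    rintro x ⟨-, hx⟩
    rcases Relation.ReflTransGen.cases_head hx with h | ⟨u, hu, hux⟩
    · left; exact h.symm
    · right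
      exact Set.mem_biUnion (x := u) hu ⟨hu.1, hux⟩
  obtain ⟨u, huj, hvu, huinf⟩ := hex
  have hu1 : u ∈ M.dagG w (j + 1) := by
    rw [hG]; exact ⟨huj, huinf⟩
  refine ⟨u, hvu, ?_⟩
  rw [dagRank_eq_iff]
  refine ⟨hu1, fun hu2 => ?_⟩
  rw [dagG, if_neg hne] at hu2
  obtain ⟨-, v', hv', hF⟩ := hu2
  exact hnacc v' ⟨h1, Relation.ReflTransGen.head ⟨hu1, hvu⟩ hv'.2⟩ hF

end BA

theorem stmt3 {A Q : Type*} [Fintype A] [Nonempty A] [Fintype Q] (M : BA A Q)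
    (w : ℕ → A) (q : Q) (i : ℕ) (hv : (q, i) ∈ M.dagV w)
    (r : ℕ) (hr : M.dagRank w (q, i) = (r : ℕ∞)) (hodd : Odd r) :
    (∃ q' ∈ M.δ q (w i), M.dagRank w (q', i + 1) = (r : ℕ∞)) ∧
    ∃ π : ℕ → Q, π 0 = q ∧
      (∀ j, M.dagEdge w (π j, i + j) (π (j + 1), i + (j + 1))) ∧
      ∀ j, M.dagRank w (π j, i + j) = (r : ℕ∞) := by
  have step : ∀ (p : Q) (k : ℕ), M.dagRank w (p, k) = (r : ℕ∞) →
      ∃ p', M.dagEdge w (p, k) (p', k + 1) ∧ M.dagRank w (p', k + 1) = (r : ℕ∞) := by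
    intro p k h
    obtain ⟨⟨p', k'⟩, he, hu⟩ := M.odd_rank_step w (p, k) r h hodd
    have hk : k' = k + 1 := he.2.2.1
    subst hk
    exact ⟨p', he, hu⟩
  constructor
  · obtain ⟨p', he, hu⟩ := step q i hr
    exact ⟨p', he.2.2.2, hu⟩
  · choose! f hf1 hf2 using step
    let π : ℕ → Q := fun n => Nat.rec q (fun j p => f p (i + j)) n
    have hπ : ∀ j, M.dagRank w (π j, i + j) = (r : ℕ∞) := by
      intro j
      induction j with
      | zero => exact hr
      | succ j ih => exact hf2 (π j) (i + j) ih
    exact ⟨π, rfl, fun j => hf1 (π j) (i + j) (hπ j), hπ⟩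
end
end

section
/- For every Büchi automaton A, L(Delay(A)) = L(Schewe(A)). Moreover, for every accepting super-tight run of Schewe(A) on a word w, there is an accepting super-tight run of Delay(A) on w. -/
/-!
Common definitions: Büchi automata, runs, languages, run DAGs and their ranks,
level rankings, tight rankings, the Schewe complementation construction and its
optimizations (Delay, SuccRank, RankSim, RankRestr, MaxRank).
-/

noncomputable section
open scoped Classical

/-! ### Statement -/

open BA

namespace DelayProof

variable {A Q : Type*} [Fintype Q]

/-- In a finite-valued sequence, eventually only values occurring infinitely often appear. -/
theorem eventually_recurrent {X : Type*} [Finite X] (s : ℕ → X) :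
    ∃ N, ∀ k, N ≤ k → ∀ n, ∃ j, n ≤ j ∧ s j = s k := by
  have h : ∀ x : X, ∃ b : ℕ, (∀ n, ∃ j, n ≤ j ∧ s j = x) ∨ ∀ j, b ≤ j → s j ≠ x := by
    intro x
    by_cases hx : ∀ n, ∃ j, n ≤ j ∧ s j = x
    · exact ⟨0, Or.inl hx⟩
    · push Not at hx
      obtain ⟨b, hb⟩ := hx
      exact ⟨b, Or.inr hb⟩
  choose b hb using h
  have := Fintype.ofFinite X
  refine ⟨Finset.univ.sup b, fun k hk => ?_⟩
  rcases hb (s k) with h1 | h1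
  · exact h1
  · exact absurd rfl (h1 k (le_trans (Finset.le_sup (f := b) (Finset.mem_univ (s k))) hk))

theorem dSteps_dIter (M : BA A Q) (w : ℕ → A) (S : Set Q) (n : ℕ) :
    ∀ k, ∃ u : List A, M.dSteps u (M.dIter w S k) = M.dIter w S (k + n) := by
  induction n with
  | zero => exact fun k => ⟨[], rfl⟩
  | succ n ih =>
    intro k
    obtain ⟨u, hu⟩ := ih (k + 1)
    refine ⟨w k :: u, ?_⟩
    rw [show k + (n + 1) = k + 1 + n by omega, ← hu]
    rfl

theorem delay_sub (M : BA A Q) (m : Mac Q) (a : A) : M.delayDelta m a ⊆ M.scheweDelta m a := by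
  cases m with
  | wait S =>
    rintro x (hx | ⟨_, hx⟩)
    · exact Or.inl hx
    · exact Or.inr hx
  | tight S O f i => exact fun x hx => hx

theorem step_S (M : BA A Q) (x y : Mac Q) (a : A) (h : y ∈ M.scheweDelta x a) :
    y.S = M.δS x.S a := by
  cases x with
  | wait S =>
    rcases h with h | ⟨f, h, _⟩
    · rw [Set.mem_singleton_iff.1 h]; rfl
    · rw [h]; rfl
  | tight S O f i =>
    obtain ⟨S', O', f', i', rfl, _, h3⟩ := h
    exact h3.1

theorem run_S (M : BA A Q) {w : ℕ → A} {ρ : ℕ → Mac Q} (h : (BA.schewe M).IsRun w ρ) (k : ℕ) :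
    (ρ k).S = M.dIter w M.I k := by
  induction k with
  | zero =>
    have h0 : ρ 0 = Mac.wait M.I := h.1
    rw [h0]; rfl
  | succ k ih =>
    rw [step_S M _ _ _ (h.2 k), ih]; rfl

theorem accept_O (M : BA A Q) (x : Mac Q) (h : x ∈ M.scheweAccept) : x.Oc = ∅ := by
  rcases h with h | ⟨S, f, i, h, _⟩
  · rw [Set.mem_singleton_iff.1 h]; rfl
  · rw [h]; rfl

/-- Everything we need about the tight part of a run. -/
structure Good (M : BA A Q) (x : Mac Q) (r : ℕ) : Prop where
  q2 : M.InQ2 x.S x.Oc x.fc x.ic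
  eq : x = Mac.tight x.S x.Oc x.fc x.ic
  rk : rankOf x.fc = r
  lt : x.ic < r + 1

theorem good_step (M : BA A Q) (x y : Mac Q) (a : A) (r : ℕ) (hx : Good M x r)
    (h : y ∈ M.scheweDelta x a) :
    Good M y r ∧ (x.Oc = ∅ → y.ic = (x.ic + 2) % (r + 1)) ∧ (x.Oc ≠ ∅ → y.ic = x.ic) := by
  have hlt := hx.lt
  have hrk := hx.rk
  have he := hx.eq
  cases x with
  | wait S => exact absurd he (by simp)
  | tight S O f i =>
    obtain ⟨S', O', f', i', rfl, hq, _, _, hr, h4⟩ := h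
    simp only [Mac.ic, Mac.fc, Mac.Oc] at *
    have hr' : rankOf f' = r := hr.trans hrk
    rw [hr'] at h4
    refine ⟨⟨hq, rfl, hr', ?_⟩, ?_, ?_⟩
    · show i' < r + 1
      rcases h4 with h4 | h4
      · rw [h4.2.1]; exact Nat.mod_lt _ (by omega)
      · rw [h4.2.1]; exact hlt
    · intro hO
      rcases h4 with h4 | h4
      · exact h4.2.1
      · exact absurd hO h4.1
    · intro hO
      rcases h4 with h4 | h4
      · exact absurd h4.1 hO
      · exact h4.2.1

theorem good_run (M : BA A Q) {w : ℕ → A} {ρ : ℕ → Mac Q} {m : ℕ}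
    (h : (BA.schewe M).IsRun w ρ) (hs : SwitchesAt ρ m) :
    ∃ r, ∀ k, m < k → Good M (ρ k) r := by
  obtain ⟨S, hS⟩ := hs.1 m le_rfl
  obtain ⟨S', O', f', i', hT⟩ := hs.2 (m + 1) (by omega)
  have h1 : ρ (m + 1) ∈ M.scheweDelta (ρ m) (w m) := h.2 m
  rw [hS] at h1
  refine ⟨rankOf (ρ (m + 1)).fc, fun k hk => ?_⟩
  induction k, hk using Nat.le_induction with
  | base =>
    rcases h1 with h1 | ⟨f, h1, hq⟩
    · rw [hT] at h1; exact absurd h1 (by simp)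
    · rw [Nat.succ_eq_add_one, h1]
      exact ⟨hq, rfl, rfl, Nat.succ_pos _⟩
  | succ k hk ih => exact (good_step M _ _ _ _ ih (h.2 k)).1

/-- The breakpoint index returns to `0` with empty `O` infinitely often. -/
theorem zero_break (M : BA A Q) {w : ℕ → A} {ρ : ℕ → Mac Q} {m r : ℕ}
    (h : (BA.schewe M).IsRun w ρ) (ha : (BA.schewe M).Accepting ρ)
    (hg : ∀ k, m < k → Good M (ρ k) r) (n : ℕ) :
    ∃ k, n ≤ k ∧ (ρ k).Oc = ∅ ∧ (ρ k).ic = 0 := by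
  -- from any point, the next empty breakpoint carries the same index
  have next : ∀ d k, m < k → (ρ (k + d)).Oc = ∅ →
      ∃ j, k ≤ j ∧ (ρ j).Oc = ∅ ∧ (ρ j).ic = (ρ k).ic := by
    intro d
    induction d with
    | zero => exact fun k _ hO => ⟨k, le_rfl, hO, rfl⟩
    | succ d ih =>
      intro k hk hO
      by_cases hE : (ρ k).Oc = ∅
      · exact ⟨k, le_rfl, hE, rfl⟩
      · obtain ⟨j, hj, hjO, hji⟩ := ih (k + 1) (by omega)
          (by rw [show k + 1 + d = k + (d + 1) by omega]; exact hO)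
        exact ⟨j, by omega, hjO,
          hji.trans ((good_step M _ _ _ _ (hg k hk) (h.2 k)).2.2 hE)⟩
  have next' : ∀ k, m < k → ∃ j, k ≤ j ∧ (ρ j).Oc = ∅ ∧ (ρ j).ic = (ρ k).ic := by
    intro k hk
    obtain ⟨j, hj, hF⟩ := ha k
    exact next (j - k) k hk (by rw [show k + (j - k) = j by omega]; exact accept_O M _ hF)
  have main : ∀ d k, m < k → n ≤ k → (ρ k).Oc = ∅ → r + 1 - (ρ k).ic ≤ d →
      ∃ k, n ≤ k ∧ (ρ k).Oc = ∅ ∧ (ρ k).ic = 0 := by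
    intro d
    induction d with
    | zero =>
      intro k hk _ _ hd
      have := (hg k hk).lt
      omega
    | succ d ih =>
      intro k hk hn hO hd
      obtain ⟨g1, g2, _⟩ := good_step M _ _ _ _ (hg k hk) (h.2 k)
      have hi := g2 hO
      obtain ⟨j, hj, hjO, hji⟩ := next' (k + 1) (by omega)
      have hlt := (hg k hk).lt
      have hev : Even (ρ k).ic := (hg k hk).q2.2.2.1
      have hodd : Odd r := by
        have := (hg k hk).q2.1.2.1
        rwa [(hg k hk).rk] at this
      rcases Nat.lt_or_ge ((ρ k).ic + 2) (r + 1) with hc | hc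
      · rw [Nat.mod_eq_of_lt hc] at hi
        exact ih j (by omega) (by omega) hjO (by omega)
      · have : (ρ k).ic + 2 = r + 1 := by
          obtain ⟨a, ha⟩ := hev
          obtain ⟨b, hb⟩ := hodd
          omega
        rw [this, Nat.mod_self] at hi
        exact ⟨j, by omega, hjO, by omega⟩
  obtain ⟨j, hj, hjO, _⟩ := next' (m + 1 + n) (by omega)
  exact main _ j (by omega) (by omega) hjO le_rfl

/-- The core: the switch to the tight part can be postponed. -/
theorem postpone (M : BA A Q) {w : ℕ → A} {ρ : ℕ → Mac Q} {m : ℕ}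
    (h : (BA.schewe M).IsRun w ρ) (ha : (BA.schewe M).Accepting ρ) (hs : SwitchesAt ρ m) :
    ∃ (ρ' : ℕ → Mac Q) (m' : ℕ), m ≤ m' ∧ (BA.delay M).IsRun w ρ' ∧
      (BA.delay M).Accepting ρ' ∧ SwitchesAt ρ' m' ∧ ∀ k, m' < k → ρ' k = ρ k := by
  obtain ⟨r, hg⟩ := good_run M h hs
  obtain ⟨N, hN⟩ := eventually_recurrent (fun k => M.dIter w M.I k)
  obtain ⟨k, hk, hkO, hki⟩ := zero_break M h ha hg (m + N + 1)
  obtain ⟨p, rfl⟩ : ∃ p, k = p + 1 := ⟨k - 1, by omega⟩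
  have hcyc : M.ClosesCycle (M.dIter w M.I p) (w p) := by
    obtain ⟨j, hj, hjp⟩ := hN p (by omega) (p + 1)
    obtain ⟨u, hu⟩ := dSteps_dIter M w M.I (j - (p + 1)) (p + 1)
    rw [show p + 1 + (j - (p + 1)) = j by omega] at hu
    exact ⟨u, hu.trans hjp⟩
  refine ⟨fun j => if j ≤ p then Mac.wait (M.dIter w M.I j) else ρ j, p, by omega,
    ⟨?_, ?_⟩, ?_, ⟨?_, ?_⟩, ?_⟩
  · show (if 0 ≤ p then _ else _) = _
    rw [if_pos (Nat.zero_le p)]; rfl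
  · intro j
    show (if j + 1 ≤ p then _ else _) ∈ M.delayDelta (if j ≤ p then _ else _) (w j)
    rcases lt_trichotomy j p with hj | hj | hj
    · rw [if_pos (by omega), if_pos (by omega)]
      exact Or.inl rfl
    · subst hj
      rw [if_neg (show ¬ j + 1 ≤ j by omega), if_pos le_rfl]
      have g := hg (j + 1) (by omega)
      have e := g.eq
      have q := g.q2
      rw [hkO, hki, run_S M h] at e q
      exact Or.inr ⟨hcyc, _, e, q⟩
    · rw [if_neg (by omega), if_neg (by omega)]
      have g := (hg j (by omega)).eq
      have := h.2 j
      rw [g] at this ⊢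
      exact this
  · intro n
    obtain ⟨j, hj, hF⟩ := ha (n + p + 1)
    refine ⟨j, by omega, ?_⟩
    show (if j ≤ p then _ else _) ∈ M.scheweAccept
    rw [if_neg (by omega)]
    exact hF
  · intro j hj
    exact ⟨_, if_pos hj⟩
  · intro j hj
    show ∃ S O f i, (if j ≤ p then _ else _) = _
    rw [if_neg (by omega)]
    exact hs.2 j (by omega)
  · intro j hj
    exact if_neg (by omega)

/-- A run either stays in the waiting part or switches exactly once. -/
theorem dichotomy (M : BA A Q) {w : ℕ → A} {ρ : ℕ → Mac Q} (h : (BA.schewe M).IsRun w ρ) :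
    (∀ k, ∃ S, ρ k = Mac.wait S) ∨ ∃ m, SwitchesAt ρ m := by
  by_cases hw : ∀ k, ∃ S, ρ k = Mac.wait S
  · exact Or.inl hw
  · right
    have hw' : ∃ k, ¬ ∃ S, ρ k = Mac.wait S := not_forall.1 hw
    have h0 : Nat.find hw' ≠ 0 := by
      intro h0
      have := Nat.find_spec hw'
      rw [h0] at this
      exact this ⟨M.I, h.1⟩
    refine ⟨Nat.find hw' - 1, fun k hk => ?_, fun k hk => ?_⟩
    · exact not_not.1 (Nat.find_min hw' (by omega))
    · have hk' : Nat.find hw' ≤ k := by omega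
      clear hk
      induction k, hk' using Nat.le_induction with
      | base =>
        have := Nat.find_spec hw'
        cases hc : ρ (Nat.find hw') with
        | wait S => exact absurd ⟨S, hc⟩ this
        | tight S O f i => exact ⟨S, O, f, i, rfl⟩
      | succ k hk ih =>
        obtain ⟨S, O, f, i, e⟩ := ih
        have := h.2 k
        rw [e] at this
        obtain ⟨S', O', f', i', e', _⟩ := this
        exact ⟨S', O', f', i', e'⟩

end DelayProof

theorem stmt4 {A Q : Type*} [Fintype A] [Nonempty A] [Fintype Q] (M : BA A Q) :
    (BA.delay M).Lang = (BA.schewe M).Lang ∧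
    ∀ (w : ℕ → A) (ρ : ℕ → Mac Q) (m : ℕ),
      (BA.schewe M).IsRun w ρ → (BA.schewe M).Accepting ρ →
      BA.SwitchesAt ρ m → M.SuperTight w ρ m →
      ∃ (ρ' : ℕ → Mac Q) (m' : ℕ),
        (BA.delay M).IsRun w ρ' ∧ (BA.delay M).Accepting ρ' ∧
        BA.SwitchesAt ρ' m' ∧ M.SuperTight w ρ' m' := by
  refine ⟨Set.Subset.antisymm ?_ ?_, ?_⟩
  · rintro w ⟨ρ, hr, ha⟩
    exact ⟨ρ, ⟨hr.1, fun i => DelayProof.delay_sub M _ _ (hr.2 i)⟩, ha⟩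
  · rintro w ⟨ρ, hr, ha⟩
    rcases DelayProof.dichotomy M hr with hw | ⟨m, hs⟩
    · refine ⟨ρ, ⟨hr.1, fun i => ?_⟩, ha⟩
      obtain ⟨S, hS⟩ := hw i
      obtain ⟨S', hS'⟩ := hw (i + 1)
      have := hr.2 i
      rw [hS, hS'] at this ⊢
      rcases this with h | ⟨f, h, _⟩
      · exact Or.inl h
      · exact absurd h (by simp)
    · obtain ⟨ρ', m', _, h1, h2, _⟩ := DelayProof.postpone M hr ha hs
      exact ⟨ρ', h1, h2⟩
  · intro w ρ m hr ha hs hst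
    obtain ⟨ρ', m', hm, h1, h2, h3, h4⟩ := DelayProof.postpone M hr ha hs
    refine ⟨ρ', m', h1, h2, h3, fun k hk => ?_⟩
    rw [h4 k hk]
    exact hst k (by omega)
end
end

section
/- For every Büchi automaton A, L(SuccRank(A)) = L(Schewe(A)), where SuccRank(A) is Schewe(A) with the tight-part macrostates restricted to those satisfying both the coarse condition rank(f) ≤ 2·maxinfreach(S) − 1 and the fine condition rank(f) ≤ min{f(q) + 2(maxinfreach(S) − mininfreach({q})) : q ∈ S}. -/
/-!
Common definitions: Büchi automata, runs, languages, run DAGs and their ranks,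
level rankings, tight rankings, the Schewe complementation construction and its
optimizations (Delay, SuccRank, RankSim, RankRestr, MaxRank).
-/

noncomputable section
open scoped Classical

/-! ### Statement -/

open BA

/-- Every tight macrostate of an infinite run has tight successors along the subset construction. -/
theorem tight_future {A Q : Type*} [Fintype Q] (M : BA A Q) (w : ℕ → A) (ρ : ℕ → Mac Q)
    (h : ∀ i, ρ (i + 1) ∈ M.scheweDelta (ρ i) (w i)) (k : ℕ) (S O : Set Q) (f : Q → ℕ) (i : ℕ)
    (hk : ρ k = Mac.tight S O f i) (hQ : M.InQ2 S O f i) (p : Q) (hp : p ∈ S) (n : ℕ) :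
    ∃ O' f' i', ρ (k + n) = Mac.tight (M.dIter (fun j => w (k + j)) S n) O' f' i' ∧
      M.InQ2 (M.dIter (fun j => w (k + j)) S n) O' f' i' ∧ rankOf f' = rankOf f ∧
      M.dIter (fun j => w (k + j)) {p} n ⊆ M.dIter (fun j => w (k + j)) S n ∧
      ∀ q ∈ M.dIter (fun j => w (k + j)) {p} n, f' q ≤ f p := by
  induction n with
  | zero =>
    refine ⟨O, f, i, hk, hQ, rfl, ?_, ?_⟩
    · simpa [dIter] using hp
    · intro q hq
      have : q = p := by simpa [dIter] using hq
      rw [this]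
  | succ n ih =>
    obtain ⟨O', f', i', h1, h2, h3, h4, h5⟩ := ih
    have hs := h (k + n)
    rw [h1] at hs
    obtain ⟨S₂, O₂, f₂, i₂, e, g2, g3, g4, g5, -⟩ := hs
    have e' : S₂ = M.dIter (fun j => w (k + j)) S (n + 1) := g3
    rw [e'] at e g2
    refine ⟨O₂, f₂, i₂, e, g2, g5.trans h3, ?_, ?_⟩
    · intro q hq
      simp only [dIter, δS, Set.mem_iUnion] at hq ⊢
      obtain ⟨r, hr, hq⟩ := hq
      exact ⟨r, h4 hr, hq⟩
    · intro q hq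
      simp only [dIter, δS, Set.mem_iUnion] at hq
      obtain ⟨r, hr, hq⟩ := hq
      exact (g4 r (h4 hr) q hq).trans (h5 r hr)

/-- A sequence in a finite type takes some value infinitely often. -/
theorem exists_inf_often {X : Type*} [Finite X] (u : ℕ → X) :
    ∃ x, ∀ m : ℕ, ∃ n, m ≤ n ∧ u n = x := by
  obtain ⟨x, hx⟩ := Finite.exists_infinite_fiber u
  refine ⟨x, fun m => ?_⟩
  rw [Set.infinite_coe_iff] at hx
  obtain ⟨n, hn, hmn⟩ := hx.exists_gt m
  exact ⟨n, hmn.le, hn⟩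

/-- Counting bound: the odd ranks above `c` are attained outside `T` and outside `F`. -/
theorem rank_count {A Q : Type*} [Fintype Q] (M : BA A Q) (S T : Set Q) (f : Q → ℕ) (c : ℕ)
    (hf : M.IsTight S f) (hTS : T ⊆ S) (hT : ∀ q ∈ T, f q ≤ c) :
    rankOf f + 2 * (T \ M.F).ncard ≤ c + 2 * (S \ M.F).ncard := by
  obtain ⟨⟨-, hF⟩, ⟨r, hr⟩, hodd, -⟩ := hf
  by_cases hc : rankOf f ≤ c
  · have : (T \ M.F).ncard ≤ (S \ M.F).ncard :=
      Set.ncard_le_ncard (Set.diff_subset_diff_left hTS) (Set.toFinite _)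
    omega
  have hex : ∀ j : ℕ, ∃ s, j ≤ r → s ∈ S ∧ f s = 2 * j + 1 := by
    intro j
    by_cases hj : j ≤ r
    · obtain ⟨s, hs, he⟩ := hodd (2 * j + 1) ⟨j, rfl⟩ (by omega)
      exact ⟨s, fun _ => ⟨hs, he⟩⟩
    · obtain ⟨s, -, -⟩ := hodd 1 ⟨0, rfl⟩ (by omega)
      exact ⟨s, fun h => absurd h hj⟩
  choose g hg using hex
  set J : Set ℕ := ↑(Finset.Ico ((c + 1) / 2) (r + 1)) with hJ
  have hmem : ∀ j ∈ J, j ≤ r ∧ (c + 1) / 2 ≤ j := by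
    intro j hj
    simp [hJ] at hj
    omega
  have hinj : Set.InjOn g J := by
    intro a ha b hb hab
    have h1 := (hg a (hmem a ha).1).2
    have h2 := (hg b (hmem b hb).1).2
    rw [hab] at h1
    omega
  have hcard : (g '' J).ncard = r + 1 - (c + 1) / 2 := by
    rw [Set.ncard_image_of_injOn hinj, hJ, Set.ncard_coe_finset, Nat.card_Ico]
  have hdisj : Disjoint (T \ M.F) (g '' J) := by
    rw [Set.disjoint_left]
    rintro q ⟨hq, -⟩ ⟨j, hj, rfl⟩
    have h1 := (hg j (hmem j hj).1).2
    have h2 := (hmem j hj).2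
    have h3 := hT _ hq
    omega
  have hsub : (T \ M.F) ∪ g '' J ⊆ S \ M.F := by
    rintro q (⟨h1, h2⟩ | ⟨j, hj, rfl⟩)
    · exact ⟨hTS h1, h2⟩
    · have h1 := hg j (hmem j hj).1
      refine ⟨h1.1, fun h => ?_⟩
      obtain ⟨t, ht⟩ := hF _ h
      omega
  have hle := Set.ncard_le_ncard hsub (Set.toFinite _)
  rw [Set.ncard_union_eq hdisj (Set.toFinite _) (Set.toFinite _), hcard] at hle
  omega

theorem le_maxinfreach {A Q : Type*} [Fintype Q] (M : BA A Q) (S R : Set Q)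
    (h : R ∈ M.infreach S) : (R \ M.F).ncard ≤ M.maxinfreach S := by
  apply le_csSup
  · refine ⟨Fintype.card Q, ?_⟩
    rintro n ⟨R', -, rfl⟩
    rw [← Nat.card_eq_fintype_card]
    exact Set.ncard_le_card _
  · exact ⟨R, h, rfl⟩

theorem mininfreach_le {A Q : Type*} [Fintype Q] (M : BA A Q) (S R : Set Q)
    (h : R ∈ M.infreach S) : M.mininfreach S ≤ (R \ M.F).ncard :=
  Nat.sInf_le ⟨R, h, rfl⟩

/-- Tight macrostates on infinite runs automatically satisfy both SuccRank conditions. -/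
theorem conds_of_run {A Q : Type*} [Fintype Q] (M : BA A Q) (w : ℕ → A) (ρ : ℕ → Mac Q)
    (h : ∀ i, ρ (i + 1) ∈ M.scheweDelta (ρ i) (w i)) (k : ℕ) (S O : Set Q) (f : Q → ℕ) (i : ℕ)
    (hk : ρ k = Mac.tight S O f i) (hQ : M.InQ2 S O f i) :
    M.CondCoarse S f ∧ M.CondFine S f := by
  have key : ∀ p ∈ S, ∃ R T, R ∈ M.infreach S ∧ T ∈ M.infreach {p} ∧
      (rankOf f + 2 * (T \ M.F).ncard ≤ f p + 2 * (R \ M.F).ncard) ∧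
      rankOf f + 1 ≤ 2 * (R \ M.F).ncard := by
    intro p hp
    obtain ⟨⟨R, T⟩, hRT⟩ := exists_inf_often (fun n =>
      (M.dIter (fun j => w (k + j)) S n, M.dIter (fun j => w (k + j)) {p} n))
    have hRT' : ∀ m : ℕ, ∃ n, m ≤ n ∧ M.dIter (fun j => w (k + j)) S n = R ∧
        M.dIter (fun j => w (k + j)) {p} n = T := by
      intro m
      obtain ⟨n, h1, h2⟩ := hRT m
      exact ⟨n, h1, (Prod.mk.inj h2).1, (Prod.mk.inj h2).2⟩
    refine ⟨R, T, ⟨fun j => w (k + j), fun m => ?_⟩, ⟨fun j => w (k + j), fun m => ?_⟩, ?_⟩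
    · obtain ⟨n, h1, h2, -⟩ := hRT' m
      exact ⟨n, h1, h2⟩
    · obtain ⟨n, h1, -, h2⟩ := hRT' m
      exact ⟨n, h1, h2⟩
    · obtain ⟨n, -, h1, h2⟩ := hRT' 0
      obtain ⟨O', f', i', -, g2, g3, g4, g5⟩ := tight_future M w ρ h k S O f i hk hQ p hp n
      rw [h1] at g2 g4
      rw [h2] at g4 g5
      have a1 := rank_count M R T f' (f p) g2.1 g4 g5
      have a2 := rank_count M R ∅ f' 0 g2.1 (Set.empty_subset _) (by simp)
      obtain ⟨r, hr⟩ := g2.1.2.1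
      simp only [Set.empty_diff, Set.ncard_empty] at a2
      constructor <;> omega
  constructor
  · obtain ⟨r, hr⟩ := hQ.1.2.1
    obtain ⟨p, hp, -⟩ := hQ.1.2.2.1 1 ⟨0, rfl⟩ (by omega)
    obtain ⟨R, T, hR, -, -, h1⟩ := key p hp
    have := le_maxinfreach M S R hR
    unfold CondCoarse
    omega
  · intro p hp
    obtain ⟨R, T, hR, hT, h1, -⟩ := key p hp
    have := le_maxinfreach M S R hR
    have := mininfreach_le M {p} T hT
    omega

theorem stmt6 {A Q : Type*} [Fintype A] [Nonempty A] [Fintype Q] (M : BA A Q) :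
    (M.restrictTight fun S _O f _i => M.CondCoarse S f ∧ M.CondFine S f).Lang
      = (BA.schewe M).Lang := by
  ext w
  constructor
  · rintro ⟨ρ, ⟨h0, h1⟩, hacc⟩
    exact ⟨ρ, ⟨h0, fun i => (h1 i).1⟩, fun n => by
      obtain ⟨i, hi, h⟩ := hacc n
      exact ⟨i, hi, h.1⟩⟩
  · rintro ⟨ρ, ⟨h0, h1⟩, hacc⟩
    have hstep : ∀ i, ρ (i + 1) ∈ M.scheweDelta (ρ i) (w i) := h1
    have hinit : ρ 0 = Mac.wait M.I := h0
    have hcond : ∀ k S O f i, ρ k = Mac.tight S O f i → M.CondCoarse S f ∧ M.CondFine S f := by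
      intro k S O f i hk
      refine conds_of_run M w ρ hstep k S O f i hk ?_
      cases k with
      | zero => rw [hinit] at hk; cases hk
      | succ k =>
        have hs := hstep k
        rw [hk] at hs
        cases hρ : ρ k with
        | wait S' =>
          rw [hρ] at hs
          rcases hs with hs | ⟨f', he, hq⟩
          · cases hs
          · cases he
            exact hq
        | tight S' O' f' i' =>
          rw [hρ] at hs
          obtain ⟨S₂, O₂, f₂, i₂, he, hq, -⟩ := hs
          cases he
          exact hq
    exact ⟨ρ, ⟨h0, fun i => ⟨h1 i, fun S O f j he => hcond (i + 1) S O f j he⟩⟩, fun n => by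
      obtain ⟨i, hi, h⟩ := hacc n
      exact ⟨i, hi, h, fun S O f j he => hcond i S O f j he⟩⟩
end
end

section
/- Let ρ = S₀ … S_m (S_{m+1},O_{m+1},f_{m+1},i_{m+1}) … be an accepting super-tight run of Schewe(A) on a word w. Then for every k > m, the coarse condition holds at position k: rank(f_k) ≤ 2·maxinfreach(S_k) − 1. -/
/-!
Common definitions: Büchi automata, runs, languages, run DAGs and their ranks,
level rankings, tight rankings, the Schewe complementation construction and its
optimizations (Delay, SuccRank, RankSim, RankRestr, MaxRank).
-/

noncomputable section
open scoped Classical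

/-! ### Statement -/

open BA

theorem aux_step {A Q : Type*} [Fintype Q] (M : BA A Q)
    (w : ℕ → A) (ρ : ℕ → Mac Q) (m : ℕ)
    (hrun : (BA.schewe M).IsRun w ρ) (hsw : BA.SwitchesAt ρ m) (k : ℕ) (hk : m < k) :
    (ρ (k+1)).S = M.δS (ρ k).S (w k) ∧ rankOf (ρ (k+1)).fc = rankOf (ρ k).fc ∧
      M.IsTight (ρ (k+1)).S (ρ (k+1)).fc := by
  obtain ⟨S, O, f, i, h⟩ := hsw.2 k hk
  have h1 := hrun.2 k
  rw [h] at h1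
  obtain ⟨S', O', f', i', e, h2, h3⟩ := h1
  rw [h, e]
  exact ⟨h3.1, h3.2.2.1, h2.1⟩

theorem aux_card {A Q : Type*} [Fintype Q] (M : BA A Q) (S : Set Q) (f : Q → ℕ)
    (h : M.IsTight S f) : rankOf f + 1 ≤ 2 * (S \ M.F).ncard := by
  obtain ⟨⟨_, hF⟩, ⟨c, hc⟩, h3, _⟩ := h
  have hex : ∀ j ∈ Finset.range (c+1), ∃ s ∈ S, f s = 2*j+1 := fun j hj =>
    h3 _ ⟨j, rfl⟩ (by have := Finset.mem_range.1 hj; omega)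
  have hsub : ((Finset.range (c+1)).image (fun j => 2*j+1) : Set ℕ) ⊆ f '' (S \ M.F) := by
    intro x hx
    simp only [Finset.coe_image, Set.mem_image, Finset.mem_coe] at hx
    obtain ⟨j, hj, rfl⟩ := hx
    obtain ⟨s, hs, e⟩ := hex j hj
    refine ⟨s, ⟨hs, fun hsF => ?_⟩, e⟩
    obtain ⟨t, ht⟩ := hF s hsF
    omega
  have h1 := Set.ncard_le_ncard hsub (Set.toFinite _)
  rw [Set.ncard_coe_finset, Finset.card_image_of_injective _ (fun a b h => by simpa using h),
    Finset.card_range] at h1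
  have h2 := Set.ncard_image_le (f := f) (Set.toFinite (S \ M.F))
  omega

theorem stmt7 {A Q : Type*} [Fintype A] [Nonempty A] [Fintype Q] (M : BA A Q)
    (w : ℕ → A) (ρ : ℕ → Mac Q) (m : ℕ)
    (hrun : (BA.schewe M).IsRun w ρ) (hacc : (BA.schewe M).Accepting ρ)
    (hsw : BA.SwitchesAt ρ m) (hst : M.SuperTight w ρ m) :
    ∀ k, m < k → (BA.rankOf ((ρ k).fc) : ℤ) ≤ 2 * (M.maxinfreach ((ρ k).S) : ℤ) - 1 := by
  intro k hk
  have hS : ∀ n, (ρ (k+n)).S = M.dIter (fun n => w (k+n)) (ρ k).S n := by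
    intro n
    induction n with
    | zero => rfl
    | succ n ih =>
      rw [dIter, ← ih]
      exact (aux_step M w ρ m hrun hsw (k+n) (by omega)).1
  have hr : ∀ n, rankOf (ρ (k+n)).fc = rankOf (ρ k).fc := by
    intro n
    induction n with
    | zero => rfl
    | succ n ih =>
      rw [← ih]
      exact (aux_step M w ρ m hrun hsw (k+n) (by omega)).2.1
  obtain ⟨R, hR⟩ := Finite.exists_infinite_fiber (fun n => (ρ (k+n)).S)
  have hinf : ∀ N : ℕ, ∃ n, N ≤ n ∧ (ρ (k+n)).S = R := by
    intro N
    obtain ⟨n, hn, hN⟩ := (Set.infinite_coe_iff.1 hR).exists_gt N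
    exact ⟨n, hN.le, hn⟩
  have hmem : R ∈ M.infreach (ρ k).S := by
    refine ⟨fun n => w (k+n), fun N => ?_⟩
    obtain ⟨n, h1, h2⟩ := hinf N
    exact ⟨n, h1, by rw [← hS, h2]⟩
  have hle : (R \ M.F).ncard ≤ M.maxinfreach (ρ k).S := by
    refine le_csSup ⟨Nat.card Q, ?_⟩ ⟨R, hmem, rfl⟩
    rintro _ ⟨R', _, rfl⟩
    exact Set.ncard_le_card _
  obtain ⟨n, h1, h2⟩ := hinf 1
  obtain ⟨n, rfl⟩ : ∃ n', n = n' + 1 := ⟨n-1, by omega⟩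
  have ht := aux_card M _ _ (aux_step M w ρ m hrun hsw (k+n) (by omega)).2.2
  have e : k + n + 1 = k + (n+1) := rfl
  rw [e, hr, h2] at ht
  omega
end
end

section
/- Let A be a Büchi automaton, p,r states of A with p ⊑_di r (p is directly simulated by r), w an infinite word, and G_w = (V,E) the run DAG of A over w. Then for all i ≥ 0, if (p,i) ∈ V and (r,i) ∈ V, then rank_w(p,i) ≤ rank_w(r,i). -/
/-!
Common definitions: Büchi automata, runs, languages, run DAGs and their ranks,
level rankings, tight rankings, the Schewe complementation construction and its
optimizations (Delay, SuccRank, RankSim, RankRestr, MaxRank).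
-/

noncomputable section
open scoped Classical

/-! ### Statement -/

open BA

theorem dagV_step_sim {A Q : Type*} (M : BA A Q) (R : Q → Q → Prop) (hR : M.IsDirSimRel R)
    (w : ℕ → A) (k : ℕ) (p' r r' : Q) (hp : (p', k + 1) ∈ M.dagV w) (hr : (r, k) ∈ M.dagV w)
    (hd : r' ∈ M.δ r (w k)) (h : R p' r') : (r', k + 1) ∈ M.dagV w := by
  obtain ⟨ρ, ⟨-, hρ⟩, hρk⟩ := hp
  obtain ⟨σ, ⟨hσ0, hσ⟩, hσk⟩ := hr
  simp only at hρk hσk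
  have step : ∀ n (x : {x // R (ρ (k + 1 + n)) x}),
      ∃ y : {x // R (ρ (k + 1 + (n + 1))) x}, y.1 ∈ M.δ x.1 (w (k + 1 + n)) := by
    intro n x
    obtain ⟨y, hy, hy'⟩ := (hR _ _ x.2).2 _ _ (hρ (k + 1 + n))
    exact ⟨⟨y, hy'⟩, hy⟩
  choose f hf using step
  have h0 : R (ρ (k + 1 + 0)) r' := by
    rw [Nat.add_zero, hρk]; exact h
  let τ : ∀ n, {x // R (ρ (k + 1 + n)) x} := fun n =>
    Nat.rec (motive := fun n => {x // R (ρ (k + 1 + n)) x}) ⟨r', h0⟩ (fun n x => f n x) n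
  have hτ : ∀ n, (τ (n + 1)).1 ∈ M.δ (τ n).1 (w (k + 1 + n)) := fun n => hf n (τ n)
  have hτ0 : (τ 0).1 = r' := rfl
  obtain ⟨t, ht0, ht⟩ : ∃ t : ℕ → Q, t 0 = r' ∧ ∀ n, t (n + 1) ∈ M.δ (t n) (w (k + 1 + n)) :=
    ⟨fun n => (τ n).1, hτ0, hτ⟩
  refine ⟨fun n => if n ≤ k then σ n else t (n - (k + 1)), ⟨by simpa using hσ0, ?_⟩, ?_⟩
  · intro n
    rcases lt_trichotomy n k with hn | hn | hn
    · have h1 : n + 1 ≤ k := hn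
      simp only [h1, hn.le, if_true]
      exact hσ n
    · subst hn
      simp [hσk, ht0, hd]
    · obtain ⟨m, rfl⟩ := Nat.exists_eq_add_of_lt hn
      have e1 : k + m + 1 + 1 - (k + 1) = m + 1 := by omega
      have e2 : k + m + 1 - (k + 1) = m := by omega
      have h1 : ¬ (k + m + 1 + 1 ≤ k) := by omega
      have h2 : ¬ (k + m + 1 ≤ k) := by omega
      simp only [h1, h2, if_false, e1, e2]
      have := ht m
      rwa [show k + 1 + m = k + m + 1 by omega] at this
  · simp [ht0]

theorem dagG_sub_dagV {A Q : Type*} (M : BA A Q) (w : ℕ → A) (j : ℕ) :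
    M.dagG w j ⊆ M.dagV w := by
  induction j with
  | zero => exact fun _ h => h
  | succ j ih =>
    intro v hv
    rw [dagG] at hv
    split_ifs at hv <;> exact ih hv.1

theorem reach_sim {A Q : Type*} (M : BA A Q) (R : Q → Q → Prop) (hR : M.IsDirSimRel R)
    (w : ℕ → A) (U : Set (Q × ℕ)) (hUV : U ⊆ M.dagV w)
    (hU : ∀ p r i, R p r → (p, i) ∈ U → (r, i) ∈ M.dagV w → (r, i) ∈ U)
    (p r : Q) (i : ℕ) (h : R p r) (hr : (r, i) ∈ U) (v : Q × ℕ)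
    (hv : M.reachIn w U (p, i) v) :
    ∃ r', R v.1 r' ∧ (r', v.2) ∈ U ∧ M.reachIn w U (r, i) (r', v.2) := by
  obtain ⟨-, hv⟩ := hv
  induction hv with
  | refl => exact ⟨r, h, hr, hr, .refl⟩
  | @tail b c _ hbc ih =>
    obtain ⟨x, hx, hxU, hx1, hx2⟩ := ih
    obtain ⟨hcU, -, hcV, hc2, hc1⟩ := hbc
    obtain ⟨b1, b2⟩ := b
    obtain ⟨c1, c2⟩ := c
    simp only at hc2 hc1 hx hxU hx2 ⊢
    subst hc2
    obtain ⟨y, hy, hy'⟩ := (hR _ _ hx).2 _ _ hc1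
    have hyV := dagV_step_sim M R hR w b2 c1 x y hcV (hUV hxU) hy hy'
    have hyU := hU _ _ _ hy' hcU hyV
    exact ⟨y, hy', hyU, hx1, hx2.tail ⟨hyU, hUV hxU, hyV, rfl, hy⟩⟩

theorem dagG_sim {A Q : Type*} [Fintype Q] (M : BA A Q) (R : Q → Q → Prop)
    (hR : M.IsDirSimRel R) (w : ℕ → A) (j : ℕ) :
    ∀ p r i, R p r → (p, i) ∈ M.dagG w j → (r, i) ∈ M.dagV w → (r, i) ∈ M.dagG w j := by
  induction j with
  | zero => exact fun _ _ _ _ _ h => h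
  | succ j ih =>
    intro p r i h hp hr
    have key := fun hr' => reach_sim M R hR w _ (dagG_sub_dagV M w j) ih p r i h hr'
    rw [dagG] at hp ⊢
    split_ifs at hp ⊢ with hj
    · have hr' := ih p r i h hp.1 hr
      refine ⟨hr', fun hfin => hp.2 ?_⟩
      refine ((Set.finite_univ (α := Q)).prod (hfin.image Prod.snd)).subset ?_
      intro v hv
      obtain ⟨x, -, -, hx⟩ := key hr' v hv
      exact ⟨trivial, (x, v.2), hx, rfl⟩
    · have hr' := ih p r i h hp.1 hr
      obtain ⟨v, hv, hF⟩ := hp.2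
      obtain ⟨x, hx, -, hx'⟩ := key hr' v hv
      exact ⟨hr', _, hx', (hR _ _ hx).1 hF⟩

theorem stmt10 {A Q : Type*} [Fintype A] [Nonempty A] [Fintype Q] (M : BA A Q)
    (p r : Q) (h : M.DirSim p r) (w : ℕ → A) (i : ℕ)
    (hp : (p, i) ∈ M.dagV w) (hr : (r, i) ∈ M.dagV w) :
    M.dagRank w (p, i) ≤ M.dagRank w (r, i) := by
  obtain ⟨R, hR, hpr⟩ := h
  refine le_sInf ?_
  rintro _ ⟨n, rfl, -, hn⟩
  have hpn : (p, i) ∉ M.dagG w (n + 1) := fun hc => hn (dagG_sim M R hR w _ p r i hpr hc hr)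
  have hex : ∀ n, (p, i) ∉ M.dagG w (n + 1) →
      ∃ m ≤ n, (p, i) ∈ M.dagG w m ∧ (p, i) ∉ M.dagG w (m + 1) := by
    intro n
    induction n with
    | zero => exact fun h => ⟨0, le_rfl, hp, h⟩
    | succ n ih =>
      intro h
      by_cases hc : (p, i) ∈ M.dagG w (n + 1)
      · exact ⟨n + 1, le_rfl, hc, h⟩
      · obtain ⟨m, hm, h'⟩ := ih hc
        exact ⟨m, by omega, h'⟩
  obtain ⟨m, hm, h1, h2⟩ := hex n hpn
  have hle : M.dagRank w (p, i) ≤ (m : ℕ∞) := sInf_le ⟨m, rfl, h1, h2⟩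
  exact hle.trans (by exact_mod_cast hm)
end
end
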